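/- Let n1, k1, n2, k2 be positive integers with n1·k2 = n2·k1 and with n1 dividing k1. Let E1 and E2 be finite types of cardinality n1·k2 = n2·k1, and let u1 : E1 → Fin n1, v1 : E1 → Fin k1, u2 : E2 → Fin n2, v2 : E2 → Fin k2 be functions such that every fiber of u1 has exactly k2 elements, every fiber of v1 has exactly n2 elements, every fiber of u2 has exactly k1 elements, and every fiber of v2 has exactly n1 elements. Then there exists a bijection ψ : E1 ≃ E2 such that: (a) for every (x, y) : Fin n2 × Fin k1 there is exactly one e : E1 with u2 (ψ e) = x and v1 e = y; and (b) for every (x, y) : Fin n1 × Fin k2 there is exactly one e : E2 with u1 (ψ⁻¹ e) = x and v2 e = y. -/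

import Mathlib

open Finset in
/-- A regular bipartite multigraph of positive degree has a perfect matching. -/
theorem exists_perfectMatching_of_regular {E X Y : Type*} [Fintype X] [Fintype Y]
    [DecidableEq E] [DecidableEq X] [DecidableEq Y] (u : E → X) (v : E → Y) (n : ℕ) (S : Finset E)
    (hu : ∀ x, #{e ∈ S | u e = x} = n + 1) (hv : ∀ y, #{e ∈ S | v e = y} = n + 1) :
    ∃ M ⊆ S, (∀ x, #{e ∈ M | u e = x} = 1) ∧ ∀ y, #{e ∈ M | v e = y} = 1 := by
  have hX : #S = #(univ : Finset X) * (n + 1) :=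
    (card_eq_sum_card_fiberwise fun e _ => mem_coe.2 (mem_univ (u e))).trans
      (sum_const_nat fun z _ => hu z)
  have hY : #S = #(univ : Finset Y) * (n + 1) :=
    (card_eq_sum_card_fiberwise fun e _ => mem_coe.2 (mem_univ (v e))).trans
      (sum_const_nat fun z _ => hv z)
  have hXY : Fintype.card Y = Fintype.card X := by
    rw [hX] at hY
    exact (Nat.eq_of_mul_eq_mul_right n.succ_pos hY).symm
  obtain ⟨f, hf, hft⟩ := (all_card_le_biUnion_card_iff_exists_injective
    (fun y => {e ∈ S | v e = y}.image u)).1 (by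
      intro A
      refine Nat.le_of_mul_le_mul_right ?_ n.succ_pos
      have h₁ : #{e ∈ S | v e ∈ A} = #A * (n + 1) := by
        rw [card_eq_sum_card_fiberwise (f := v) (t := A) 
          (fun e he => mem_coe.2 (mem_filter.1 (mem_coe.1 he)).2)]
        rw [sum_const_nat]
        intro y hy
        rw [← hv y, filter_filter]
        congr 1
        ext e
        grind
      rw [← h₁]
      refine (card_le_mul_card_image_of_maps_to (f := u) (fun e he => ?_) (n + 1)
        fun x _ => ?_).trans_eq (mul_comm _ _)
      · simp only [mem_filter] at he
        simp only [mem_biUnion, mem_image, mem_filter]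
        exact ⟨v e, he.2, e, ⟨he.1, rfl⟩, rfl⟩
      · rw [← hu x]
        exact card_le_card (filter_subset_filter _ (filter_subset _ _)))
  have hfb : f.Bijective := (Fintype.bijective_iff_injective_and_card f).2 ⟨hf, hXY⟩
  simp only [mem_image, mem_filter] at hft
  choose g hg hgu using hft
  refine ⟨univ.image g, fun e he => ?_, fun x => ?_, fun y => ?_⟩
  · obtain ⟨y, -, rfl⟩ := mem_image.1 he
    exact (hg y).1
  · obtain ⟨y, rfl⟩ := hfb.2 x
    refine card_eq_one.2 ⟨g y, ?_⟩
    ext e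
    simp only [mem_filter, mem_image, mem_univ, true_and, mem_singleton]
    constructor
    · rintro ⟨⟨z, rfl⟩, h⟩
      rw [hgu] at h
      rw [hf h]
    · rintro rfl
      exact ⟨⟨y, rfl⟩, hgu y⟩
  · refine card_eq_one.2 ⟨g y, ?_⟩
    ext e
    simp only [mem_filter, mem_image, mem_univ, true_and, mem_singleton]
    constructor
    · rintro ⟨⟨z, rfl⟩, h⟩
      rw [(hg z).2] at h
      rw [h]
    · rintro rfl
      exact ⟨⟨y, rfl⟩, (hg y).2⟩

open Finset in
/-- The edges of an `n`-regular bipartite multigraph can be coloured with `n` colours in such a way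
that every colour class is a perfect matching. -/
theorem exists_edgeColoring_of_regular {E X Y : Type*} [Fintype X] [Fintype Y]
    [DecidableEq E] [DecidableEq X] [DecidableEq Y] (u : E → X) (v : E → Y) (n : ℕ) (S : Finset E)
    (hu : ∀ x, #{e ∈ S | u e = x} = n) (hv : ∀ y, #{e ∈ S | v e = y} = n) :
    ∃ c : E → ℕ, (∀ e ∈ S, c e < n) ∧ ∀ i < n,
      (∀ x, #{e ∈ S | c e = i ∧ u e = x} = 1) ∧ ∀ y, #{e ∈ S | c e = i ∧ v e = y} = 1 := by
  induction n generalizing S with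
  | zero =>
    refine ⟨fun _ => 0, fun e he => ?_, by simp⟩
    have := hu (u e)
    rw [card_eq_zero, filter_eq_empty_iff] at this
    exact absurd rfl (this he)
  | succ n ih =>
    obtain ⟨M, hMS, hMu, hMv⟩ := exists_perfectMatching_of_regular u v n S hu hv
    have hsdiff (p : E → Prop) [DecidablePred p] (hS : #{e ∈ S | p e} = n + 1)
        (hM : #{e ∈ M | p e} = 1) : #{e ∈ S \ M | p e} = n := by
      have h : ({e ∈ S \ M | p e} : Finset E) = {e ∈ S | p e} \ {e ∈ M | p e} := by
        ext e
        grind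
      rw [h, card_sdiff_of_subset (filter_subset_filter _ hMS), hS, hM, Nat.add_sub_cancel]
    obtain ⟨c, hc, hcuv⟩ := ih (S \ M) (fun x => hsdiff _ (hu x) (hMu x))
      (fun y => hsdiff _ (hv y) (hMv y))
    have hcol (p : E → Prop) [DecidablePred p] (hM : #{e ∈ M | p e} = 1) (i : ℕ) (hi : i < n + 1)
        (h : i < n → #{e ∈ S \ M | c e = i ∧ p e} = 1) :
        #{e ∈ S | (if e ∈ M then n else c e) = i ∧ p e} = 1 := by
      rcases Nat.lt_succ_iff_lt_or_eq.1 hi with hi | rfl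
      · rw [← h hi]
        congr 1
        ext e
        grind
      · rw [← hM]
        congr 1
        ext e
        grind
    refine ⟨fun e => if e ∈ M then n else c e, fun e he => ?_, fun i hi => ⟨fun x => ?_, fun y => ?_⟩⟩
    · grind
    · exact hcol _ (hMu x) i hi fun h => (hcuv i h).1 x
    · exact hcol _ (hMv y) i hi fun h => (hcuv i h).2 y

/-- Two maps whose fibers have the same finite cardinalities differ by a bijection. -/
theorem exists_equiv_of_card_fiber_eq {A B Z : Type*} [Finite A] [Finite B] (f : A → Z) (g : B → Z)
    (h : ∀ z, Nat.card {a // f a = z} = Nat.card {b // g b = z}) :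
    ∃ ψ : A ≃ B, ∀ a, g (ψ a) = f a :=
  ⟨Equiv.ofFiberEquiv fun z => (Finite.card_eq.1 (h z)).some, Equiv.ofFiberEquiv_map _⟩

/-- The edges of a biregular bipartite multigraph with degrees `n * m` and `n` can be coloured with
`n` colours so that every colour occurs `m` times at each left vertex and once at each right
vertex. -/
theorem exists_edgeColoring_of_biregular {E X Y : Type*} [Finite E] [Finite X] [Finite Y]
    (u : E → X) (v : E → Y) (n m : ℕ)
    (hu : ∀ x, Nat.card {e // u e = x} = n * m) (hv : ∀ y, Nat.card {e // v e = y} = n) :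
    ∃ c : E → Fin n, (∀ i x, Nat.card {e // c e = i ∧ u e = x} = m) ∧
      ∀ i y, ∃! e, c e = i ∧ v e = y := by
  classical
  have := Fintype.ofFinite E
  have := Fintype.ofFinite X
  have := Fintype.ofFinite Y
  obtain ⟨ψ, hψ⟩ := exists_equiv_of_card_fiber_eq u (Prod.fst : X × (Fin m × Fin n) → X) (by
    intro x
    rw [hu x, Nat.card_congr (β := Fin m × Fin n)
      ⟨fun p => p.1.2, fun q => ⟨(x, q), rfl⟩, by rintro ⟨⟨_, q⟩, rfl⟩; rfl, fun _ => rfl⟩]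
    simp [mul_comm])
  let w : E → X × Fin m := fun e => ((ψ e).1, (ψ e).2.1)
  have hw (z : X × Fin m) : (Finset.univ.filter fun e => w e = z).card = n := by
    let φ : {e // w e = z} ≃ Fin n :=
      { toFun := fun e => (ψ e.1).2.2
        invFun := fun k => ⟨ψ.symm (z.1, z.2, k), by simp [w]⟩
        left_inv := by
          rintro ⟨e, rfl⟩
          simp [w]
        right_inv := fun k => by simp }
    rw [← Fintype.card_subtype, ← Nat.card_eq_fintype_card, Nat.card_congr φ, Nat.card_fin]
  obtain ⟨c, hc, hcwv⟩ := exists_edgeColoring_of_regular w v n Finset.univ hw (fun y => by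
    rw [← Fintype.card_subtype, ← Nat.card_eq_fintype_card, hv])
  refine ⟨fun e => ⟨c e, hc e (Finset.mem_univ e)⟩, fun i x => ?_, fun i y => ?_⟩
  · have hbij : Function.Bijective
        (fun e : {e // (⟨c e, hc e (Finset.mem_univ e)⟩ : Fin n) = i ∧ u e = x} =>
          (ψ e.1).2.1) := by
      rw [Function.bijective_iff_existsUnique]
      intro j
      obtain ⟨e, he⟩ := Finset.card_eq_one.1 ((hcwv i i.2).1 (x, j))
      simp only [Finset.ext_iff, Finset.mem_filter, Finset.mem_univ, true_and,
        Finset.mem_singleton, w, Prod.mk.injEq, hψ] at he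
      obtain ⟨h₁, h₂, h₃⟩ := (he e).2 rfl
      refine ⟨⟨e, Fin.ext h₁, h₂⟩, h₃, ?_⟩
      rintro ⟨a, k₁, k₂⟩ k₃
      exact Subtype.ext ((he a).1 ⟨Fin.ext_iff.1 k₁, k₂, k₃⟩)
    rw [Nat.card_congr (Equiv.ofBijective _ hbij), Nat.card_fin]
  · obtain ⟨e, he⟩ := Finset.card_eq_one.1 ((hcwv i i.2).2 y)
    simp only [Finset.ext_iff, Finset.mem_filter, Finset.mem_univ, true_and,
      Finset.mem_singleton] at he
    simp only [Fin.ext_iff]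
    exact ⟨e, (he e).2 rfl, fun a => (he a).1⟩

/-- Conjecture 5 (four parts) holds whenever `n1` divides `k1`. -/
theorem stmt3 (n1 k1 n2 k2 : ℕ) (hn1 : 0 < n1) (hk1 : 0 < k1) (hn2 : 0 < n2) (hk2 : 0 < k2)
    (hprod : n1 * k2 = n2 * k1) (hdvd : n1 ∣ k1)
    (E1 E2 : Type) [Fintype E1] [Fintype E2]
    (hE1 : Fintype.card E1 = n1 * k2) (hE2 : Fintype.card E2 = n1 * k2)
    (u1 : E1 → Fin n1) (v1 : E1 → Fin k1) (u2 : E2 → Fin n2) (v2 : E2 → Fin k2)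
    (hu1 : ∀ x : Fin n1, Nat.card {e : E1 | u1 e = x} = k2)
    (hv1 : ∀ y : Fin k1, Nat.card {e : E1 | v1 e = y} = n2)
    (hu2 : ∀ x : Fin n2, Nat.card {e : E2 | u2 e = x} = k1)
    (hv2 : ∀ y : Fin k2, Nat.card {e : E2 | v2 e = y} = n1) :
    ∃ ψ : E1 ≃ E2,
      (∀ x : Fin n2, ∀ y : Fin k1, ∃! e : E1, u2 (ψ e) = x ∧ v1 e = y) ∧
      (∀ x : Fin n1, ∀ y : Fin k2, ∃! e : E2, u1 (ψ.symm e) = x ∧ v2 e = y) := by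
  obtain ⟨m, rfl⟩ := hdvd
  obtain rfl : k2 = n2 * m := by
    refine Nat.eq_of_mul_eq_mul_left hn1 ?_
    rw [hprod]
    ring
  obtain ⟨c, hcu, hcv⟩ := exists_edgeColoring_of_biregular u1 v1 n2 m hu1 hv1
  obtain ⟨d, hdu, hdv⟩ := exists_edgeColoring_of_biregular u2 v2 n1 m hu2 hv2
  obtain ⟨ψ, hψ⟩ := exists_equiv_of_card_fiber_eq (fun e => (c e, u1 e)) (fun e => (u2 e, d e)) (by
    rintro ⟨x, y⟩
    simp only [Prod.mk.injEq]
    rw [hcu x y, ← hdu y x]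
    simp only [and_comm])
  simp only [Prod.mk.injEq] at hψ
  refine ⟨ψ, fun x y => ?_, fun x y => ?_⟩
  · simpa only [(hψ _).1] using hcv x y
  · have h (e : E2) : u1 (ψ.symm e) = d e := by simpa using (hψ (ψ.symm e)).2.symm
    simpa only [h] using hdv x y
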